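/- For any integral domain D with quotient field K ≠ D, the following conditions are equivalent: (1) every flat overring of D (a subring D' of K containing D that is flat as a D-module) satisfies Int(D,D') = D'·Int(D); (2) Int(S⁻¹D) = S⁻¹Int(D) for every multiplicative subset S of D with 0 ∉ S; (3) Int(D_p) = Int(D)_p for every prime ideal p of D; (4) Int(D_p) = Int(D)_p for every t-localizing t-maximal ideal p of D such that D/p is finite; (5) Int(D_p) = Int(D)_p for every prime ideal p of D with Int(D_p) ≠ D_p[X]. -/

import Mathlib

namespace IVP

open Polynomial

variable {F : Type} [Field F]

/-- Integer-valued polynomials on the set `E` with values in `D`: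
`Int(E,D) = {f ∈ F[X] : f(E) ⊆ D}`. -/
def IntOn (E D : Set F) : Set (Polynomial F) := {f | ∀ x ∈ E, f.eval x ∈ D}

/-- `Int(D) = {f ∈ F[X] : f(D) ⊆ D}`. -/
def IntR (D : Set F) : Set (Polynomial F) := IntOn D D

/-- Polynomials with all coefficients in `R`, i.e. `R[X]` as a subset of `F[X]`. -/
def polySet (R : Set F) : Set (Polynomial F) := {f | ∀ n, f.coeff n ∈ R}

/-- `I⁻¹ = (D :_K I) = {x : x·I ⊆ D}`. -/
def dinv (D I : Set F) : Set F := {x | ∀ y ∈ I, x * y ∈ D}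

/-- `I_v = (I⁻¹)⁻¹`. -/
def dv (D I : Set F) : Set F := dinv D (dinv D I)

/-- `I_t = ⋃ J_v`, the union over all nonzero finitely generated fractional ideals
`J ⊆ I`; such a `J` is the `D`-span of a finite set `T ⊆ I` containing a nonzero
element, and `J_v` depends only on `T`. -/
def dt (D I : Set F) : Set F :=
  {x | ∃ T : Finset F, ↑T ⊆ I ∧ (∃ y ∈ T, y ≠ 0) ∧ x ∈ dv D ↑T}

/-- The image in `F` of a set of elements of the subring `D`. -/
def iset (D : Subring F) (I : Set ↥D) : Set F := (↑) '' I

/-- `I` is a t-ideal: `I_t = I`. -/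
def IsTIdeal (D I : Set F) : Prop := dt D I = I

/-- `I` is a v-ideal: `I_v = I`. -/
def IsVIdeal (D I : Set F) : Prop := dv D I = I

/-- `p` is a t-maximal ideal of `D`: maximal among the t-ideals properly contained
in `D`. -/
def IsTMax (D : Subring F) (p : Ideal ↥D) : Prop :=
  p ≠ ⊤ ∧ IsTIdeal ↑D (iset D ↑p) ∧
    ∀ q : Ideal ↥D, q ≠ ⊤ → IsTIdeal ↑D (iset D ↑q) → p ≤ q → p = q

/-- `p` is a v-maximal ideal of `D`: maximal among the v-ideals properly contained
in `D`. -/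
def IsVMax (D : Subring F) (p : Ideal ↥D) : Prop :=
  p ≠ ⊤ ∧ IsVIdeal ↑D (iset D ↑p) ∧
    ∀ q : Ideal ↥D, q ≠ ⊤ → IsVIdeal ↑D (iset D ↑q) → p ≤ q → p = q

/-- The localization `S⁻¹D` of `D` at a multiplicative subset `S ⊆ D`, as a subset
of `F`. -/
def mlocSet (D : Subring F) (S : Set ↥D) : Set F :=
  {x | ∃ a : ↥D, ∃ s ∈ S, (s : F) * x = (a : F)}

/-- The localization `D_p` of `D` at the complement of `p`, as a subset of `F`. -/
def plocSet (D : Subring F) (p : Ideal ↥D) : Set F := mlocSet D {s | s ∉ p}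

/-- The localization `S⁻¹R` of a set `R` of polynomials at a multiplicative subset
`S ⊆ D`, as a subset of `F[X]`. -/
def mlocPoly (D : Subring F) (S : Set ↥D) (R : Set (Polynomial F)) : Set (Polynomial F) :=
  {f | ∃ g ∈ R, ∃ s ∈ S, C (s : F) * f = g}

/-- The localization `R_p` of a set `R` of polynomials at `D ∖ p`. -/
def plocPoly (D : Subring F) (p : Ideal ↥D) (R : Set (Polynomial F)) : Set (Polynomial F) :=
  mlocPoly D {s | s ∉ p} R

/-- The ideal `pD_p` of the localization `D_p`, as a subset of `F`. -/
def plocIdl (D : Subring F) (p : Ideal ↥D) : Set F :=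
  {x | ∃ y ∈ p, ∃ s : ↥D, s ∉ p ∧ (s : F) * x = ((y : ↥D) : F)}

/-- `p` is t-localizing: `pD_p` is a t-ideal of `D_p`. -/
def TLocalizing (D : Subring F) (p : Ideal ↥D) : Prop :=
  IsTIdeal (plocSet D p) (plocIdl D p)

/-- `F` is the quotient field of `D`. -/
def IsQuotField (D : Subring F) : Prop :=
  ∀ x : F, ∃ a b : ↥D, b ≠ 0 ∧ (b : F) * x = (a : F)

/-- The quotient field of `D`, as a subset of the ambient field. -/
def fracSet (D : Subring F) : Set F :=
  {x | ∃ a b : ↥D, b ≠ 0 ∧ (b : F) * x = (a : F)}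

/-- The conductor ideal `(aD :_D bD) = {d ∈ D : d·b ∈ aD}` of `D`. -/
def Conductor (D : Subring F) (a b : ↥D) : Set ↥D := {d | ∃ c : ↥D, d * b = a * c}

/-- Elementwise product of two subsets of `F`. -/
def setMul (A B : Set F) : Set F := {z | ∃ x ∈ A, ∃ y ∈ B, z = x * y}

/-- The ideal `I` of `D` is t-invertible: `(I⁻¹I)_t = D`. -/
def TInv (D : Subring F) (I : Ideal ↥D) : Prop :=
  dt ↑D (setMul (dinv ↑D (iset D ↑I)) (iset D ↑I)) = (↑D : Set F)

/-- The ideal `I` of `D` is v-invertible: `(I⁻¹I)_v = D`. -/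
def VInv (D : Subring F) (I : Ideal ↥D) : Prop :=
  dv ↑D (setMul (dinv ↑D (iset D ↑I)) (iset D ↑I)) = (↑D : Set F)

/-- `D` is a PVMD: every nonzero finitely generated ideal of `D` is t-invertible. -/
def IsPVMD (D : Subring F) : Prop :=
  ∀ I : Ideal ↥D, I ≠ ⊥ → I.FG → TInv D I

/-- `D` is an H domain: every v-invertible nonzero ideal of `D` is t-invertible. -/
def IsHDomain (D : Subring F) : Prop :=
  ∀ I : Ideal ↥D, I ≠ ⊥ → VInv D I → TInv D I

/-- `p ∈ sKr(K/D)`: `p` is a prime such that every finitely generated ideal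
`I ⊆ p` satisfies `I ⊆ J ⊆ p` for some conductor ideal `J` of `D`. -/
def SKrMem (D : Subring F) (p : Ideal ↥D) : Prop :=
  p.IsPrime ∧ ∀ I : Ideal ↥D, I.FG → I ≤ p →
    ∃ a b : ↥D, a ≠ 0 ∧ (↑I : Set ↥D) ⊆ Conductor D a b ∧ Conductor D a b ⊆ ↑p

/-- The localization `A_p` of `A ⊇ D` at the complement in `D` of a prime `p` of `D`,
as a subset of the ambient field. -/
def mixedLocSet (D A : Subring F) (p : Ideal ↥D) : Set F :=
  {x | ∃ a : ↥A, ∃ s : ↥D, s ∉ p ∧ (s : F) * x = (a : F)}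

/-- `pD_p` is a principal ideal of `D_p`. -/
def PLocPrincipal (D : Subring F) (p : Ideal ↥D) : Prop :=
  ∃ g : F, plocIdl D p = {x | ∃ d ∈ plocSet D p, x = d * g}

/-- The localization `A_p` of `A ⊇ D` at a prime `p` of `D`, as a subring of the
ambient field. -/
def mixedLoc (D A : Subring F) (hDA : D ≤ A) (p : Ideal ↥D) (hp : p.IsPrime) :
    Subring F where
  carrier := mixedLocSet D A p
  one_mem' := ⟨1, 1, fun h => hp.ne_top (Ideal.eq_top_of_isUnit_mem p h isUnit_one), by simp⟩
  zero_mem' := ⟨0, 1, fun h => hp.ne_top (Ideal.eq_top_of_isUnit_mem p h isUnit_one), by simp⟩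
  mul_mem' := by
    rintro x y ⟨a, s, hs, hx⟩ ⟨b, t, ht, hy⟩
    refine ⟨a * b, s * t, fun h => ((hp.mem_or_mem h).elim hs ht), ?_⟩
    push_cast
    rw [mul_mul_mul_comm, hx, hy]
  add_mem' := by
    rintro x y ⟨a, s, hs, hx⟩ ⟨b, t, ht, hy⟩
    refine ⟨⟨t, hDA t.2⟩ * a + ⟨s, hDA s.2⟩ * b, s * t,
      fun h => ((hp.mem_or_mem h).elim hs ht), ?_⟩
    push_cast
    rw [mul_add]
    rw [show ((s:F) * t) * x = (t:F) * ((s:F) * x) by ring, hx,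
      show ((s:F) * t) * y = (s:F) * ((t:F) * y) by ring, hy]
  neg_mem' := by
    rintro x ⟨a, s, hs, hx⟩
    exact ⟨-a, s, hs, by push_cast; rw [mul_neg, hx]⟩

/-- The localization `D_p` of `D` at a prime `p`, as a subring of `F`. -/
def primeLoc (D : Subring F) (p : Ideal ↥D) (hp : p.IsPrime) : Subring F :=
  mixedLoc D D le_rfl p hp

/-- `Int(D)` as a subring of `F[X]`. -/
def IntSubring (D : Subring F) : Subring (Polynomial F) where
  carrier := IntR ↑D
  one_mem' := fun x _ => by simpa using D.one_mem
  zero_mem' := fun x _ => by simpa using D.zero_mem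
  mul_mem' := fun hf hg x hx => by
    rw [eval_mul]; exact D.mul_mem (hf x hx) (hg x hx)
  add_mem' := fun hf hg x hx => by
    rw [eval_add]; exact D.add_mem (hf x hx) (hg x hx)
  neg_mem' := fun hf x hx => by
    rw [eval_neg]; exact D.neg_mem (hf x hx)

/-- `Int(D)` as a `D`-submodule of `F[X]`. -/
def intSubmodule (D : Subring F) : Submodule ↥D (Polynomial F) where
  carrier := IntR ↑D
  zero_mem' := fun x _ => by simpa using D.zero_mem
  add_mem' := fun hf hg x hx => by
    rw [eval_add]; exact D.add_mem (hf x hx) (hg x hx)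
  smul_mem' := fun c f hf x hx => by
    have h : c • f = C (c : F) * f := by
      rw [Algebra.smul_def]; rfl
    rw [h, eval_mul, eval_C]
    exact D.mul_mem c.2 (hf x hx)

/-- An overring `D'` of `D` as a `D`-submodule of `F`. -/
def subringSubmodule (D D' : Subring F) (h : D ≤ D') : Submodule ↥D F where
  carrier := ↑D'
  zero_mem' := D'.zero_mem
  add_mem' := fun ha hb => D'.add_mem ha hb
  smul_mem' := fun c x hx => by
    rw [Subring.smul_def]
    exact D'.mul_mem (h c.2) hx

/-- `Int(D)_p` as a `D_p`-submodule of `F[X]`. -/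
def plocIntSubmodule (D : Subring F) (p : Ideal ↥D) (hp : p.IsPrime) :
    Submodule ↥(primeLoc D p hp) (Polynomial F) where
  carrier := plocPoly D p (IntR ↑D)
  zero_mem' :=
    ⟨0, fun x _ => by simpa using D.zero_mem, 1,
      fun h => hp.ne_top (Ideal.eq_top_of_isUnit_mem p h isUnit_one), by simp⟩
  add_mem' := by
    rintro f f' ⟨g, hg, s, hs, hfg⟩ ⟨g', hg', t, ht, hfg'⟩
    refine ⟨C (t : F) * g + C (s : F) * g', ?_, s * t,
      fun h => ((hp.mem_or_mem h).elim hs ht), ?_⟩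
    · intro x hx
      rw [eval_add, eval_mul, eval_mul, eval_C, eval_C]
      exact D.add_mem (D.mul_mem t.2 (hg x hx)) (D.mul_mem s.2 (hg' x hx))
    · rw [← hfg, ← hfg']
      push_cast
      rw [map_mul]
      ring
  smul_mem' := by
    rintro c f ⟨g, hg, t, ht, hfg⟩
    obtain ⟨a, s, hs, hsc⟩ := c.2
    have h : c • f = C (c : F) * f := by rw [Algebra.smul_def]; rfl
    refine ⟨C (a : F) * g, ?_, s * t,
      fun hmem => ((hp.mem_or_mem hmem).elim hs ht), ?_⟩
    · intro x hx
      rw [eval_mul, eval_C]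
      exact D.mul_mem a.2 (hg x hx)
    · rw [h, ← hfg, ← hsc]
      push_cast
      rw [map_mul, map_mul]
      ring

section Extensions

variable {L : Type} [Field L]

/-- The data of an extension: the subring `A` of `L` contains the image of `D`
under the embedding `φ` of quotient fields. -/
def ExtMem (D : Subring F) (φ : F →+* L) (A : Subring L) : Prop := ∀ d : ↥D, φ d ∈ A

/-- The injective ring homomorphism `D → A` induced by `φ`. -/
noncomputable def extHom (D : Subring F) (φ : F →+* L) (A : Subring L)
    (h : ExtMem D φ A) : ↥D →+* ↥A :=
  (φ.comp D.subtype).codRestrict A.toSubsemiring (fun d => h d)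

/-- The extension `A ⊇ D` is polynomially regular: `Int(D,A) = A·Int(D)`. -/
def PolyReg (D : Subring F) (φ : F →+* L) (A : Subring L) : Prop :=
  IntOn (φ '' ↑D) ↑A = ↑(Submodule.span ↥A (Polynomial.map φ '' IntR (↑D : Set F)))

/-- The extension `A ⊇ D` is weakly polynomially complete: `Int(D) ⊆ Int(A)`. -/
def WPolyComplete (D : Subring F) (φ : F →+* L) (A : Subring L) : Prop :=
  Polynomial.map φ '' IntR (↑D : Set F) ⊆ IntR (↑A : Set L)

/-- The extension `A ⊇ D` is polynomially complete: `Int(D,A) = Int(A)`. -/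
def PolyComplete (D : Subring F) (φ : F →+* L) (A : Subring L) : Prop :=
  IntOn (φ '' ↑D) ↑A = IntR (↑A : Set L)

/-- The extension `A ⊇ D` is flat: `A` is flat as a `D`-module. -/
def ExtFlat (D : Subring F) (φ : F →+* L) (A : Subring L) (h : ExtMem D φ A) : Prop :=
  letI : Module ↥D ↥A := Module.compHom ↥A (extHom D φ A h)
  Module.Flat ↥D ↥A

/-- The extension `A ⊇ D` is t-linked: `I_t = D` implies `(IA)_t = A` for every
nonzero ideal `I` of `D`. -/
def TLinkedExt (D : Subring F) (φ : F →+* L) (A : Subring L) (h : ExtMem D φ A) : Prop :=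
  ∀ I : Ideal ↥D, I ≠ ⊥ → dt ↑D (iset D ↑I) = (↑D : Set F) →
    dt ↑A (iset A ↑(Ideal.map (extHom D φ A h) I)) = (↑A : Set L)

/-- `D` is absolutely polynomially regular: every extension of `D` is polynomially
regular. -/
def AbsPolyReg (D : Subring F) : Prop :=
  ∀ (L : Type) [Field L], ∀ (φ : F →+* L) (A : Subring L),
    ExtMem D φ A → IsQuotField A → PolyReg D φ A

/-- `D` is polynomially F-regular: every flat extension of `D` is polynomially
regular. -/
def PFReg (D : Subring F) : Prop :=
  ∀ (L : Type) [Field L], ∀ (φ : F →+* L) (A : Subring L) (h : ExtMem D φ A),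
    IsQuotField A → ExtFlat D φ A h → PolyReg D φ A

/-- `D` is polynomially t-regular: every t-linked extension of `D` is polynomially
regular. -/
def PTReg (D : Subring F) : Prop :=
  ∀ (L : Type) [Field L], ∀ (φ : F →+* L) (A : Subring L) (h : ExtMem D φ A),
    IsQuotField A → TLinkedExt D φ A h → PolyReg D φ A

/-- `D` is polynomially L-regular: `Int(S⁻¹D) = S⁻¹Int(D)` for every multiplicative
subset `S` of `D` with `0 ∉ S`. -/
def PLReg (D : Subring F) : Prop :=
  ∀ S : Submonoid ↥D, (0 : ↥D) ∉ S →
    IntR (mlocSet D ↑S) = mlocPoly D ↑S (IntR (↑D : Set F))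

end Extensions

/-- The extension of an ideal `I` of `R` to an overring `S` of `R` inside a common
field: the ideal `IS` of `S` generated by `I`. -/
def extIdeal (R S : Subring F) (I : Ideal ↥R) : Ideal ↥S :=
  Ideal.span {y : ↥S | (y : F) ∈ iset R ↑I}

/-- Within a common field: `S` is a t-linked extension of `R`. -/
def TLinkedSub (R S : Subring F) : Prop :=
  R ≤ S ∧ ∀ I : Ideal ↥R, I ≠ ⊥ → dt ↑R (iset R ↑I) = (↑R : Set F) →
    dt ↑S (iset S ↑(extIdeal R S I)) = (↑S : Set F)

/-- Localization of a subset `R` of the ambient field at `D ∖ q`. -/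
def locOfSet (D : Subring F) (R : Set F) (q : Ideal ↥D) : Set F :=
  {x | ∃ y ∈ R, ∃ s : ↥D, s ∉ q ∧ (s : F) * x = y}

end IVP

namespace IVP

open Polynomial

variable {F : Type} [Field F]

theorem mlocSet_mono (D : Subring F) {S T : Set ↥D} (h : S ⊆ T) : mlocSet D S ⊆ mlocSet D T :=
  fun _ ⟨a, s, hs, hx⟩ => ⟨a, s, h hs, hx⟩

/-- The localization `S⁻¹D` as a subring of `F`. -/
def mlocSubring (D : Subring F) (S : Submonoid ↥D) : Subring F where
  carrier := mlocSet D ↑S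
  one_mem' := ⟨1, 1, S.one_mem, by simp⟩
  zero_mem' := ⟨0, 1, S.one_mem, by simp⟩
  mul_mem' := by
    rintro x y ⟨a, s, hs, hx⟩ ⟨b, t, ht, hy⟩
    refine ⟨a * b, s * t, S.mul_mem hs ht, ?_⟩
    push_cast
    rw [mul_mul_mul_comm, hx, hy]
  add_mem' := by
    rintro x y ⟨a, s, hs, hx⟩ ⟨b, t, ht, hy⟩
    refine ⟨t * a + s * b, s * t, S.mul_mem hs ht, ?_⟩
    push_cast
    linear_combination (t : F) * hx + (s : F) * hy
  neg_mem' := by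
    rintro x ⟨a, s, hs, hx⟩
    exact ⟨-a, s, hs, by push_cast; rw [mul_neg, hx]⟩

theorem coe_mlocSubring (D : Subring F) (S : Submonoid ↥D) :
    (↑(mlocSubring D S) : Set F) = mlocSet D ↑S := rfl

theorem mem_mlocSubring {D : Subring F} {S : Submonoid ↥D} {x : F} :
    x ∈ mlocSubring D S ↔ ∃ a : ↥D, ∃ s ∈ S, (s : F) * x = (a : F) := Iff.rfl

theorem le_mlocSubring (D : Subring F) (S : Submonoid ↥D) : D ≤ mlocSubring D S :=
  fun x hx => ⟨⟨x, hx⟩, 1, S.one_mem, by simp⟩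

theorem inv_mem_mlocSubring {D : Subring F} {S : Submonoid ↥D} (h0 : (0 : ↥D) ∉ S)
    {s : ↥D} (hs : s ∈ S) : (s : F)⁻¹ ∈ mlocSubring D S := by
  have hs0 : (s : F) ≠ 0 := fun h => h0 (by rwa [← ZeroMemClass.coe_eq_zero.mp h])
  exact ⟨1, s, hs, by simp [hs0]⟩

/-- Finitely many elements of `S⁻¹D` have a common denominator in `S`. -/
theorem exists_common_denom (D : Subring F) (S : Submonoid ↥D) (T : Finset F)
    (hT : ∀ t ∈ T, t ∈ mlocSubring D S) : ∃ s ∈ S, ∀ t ∈ T, (s : F) * t ∈ D := by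
  classical
  induction T using Finset.induction_on with
  | empty => exact ⟨1, S.one_mem, by simp⟩
  | insert x T _ ih =>
    obtain ⟨s, hs, h⟩ := ih fun t ht => hT t (Finset.mem_insert_of_mem ht)
    obtain ⟨a, u, hu, hx⟩ := hT x (Finset.mem_insert_self _ _)
    refine ⟨s * u, S.mul_mem hs hu, fun t ht => ?_⟩
    rw [Subring.coe_mul]
    rcases Finset.mem_insert.mp ht with rfl | ht
    · rw [mul_assoc, hx]
      exact D.mul_mem s.2 a.2
    · rw [mul_comm (s : F), mul_assoc]
      exact D.mul_mem u.2 (h t ht)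

/-- A polynomial mapping `D` into an overring `R` in which the elements of `S` are invertible
maps `S⁻¹D` into `R`. -/
theorem intOn_subset_intOn_mlocSet {D R : Subring F} (hDR : D ≤ R) (S : Submonoid ↥D)
    (hS : ∀ s ∈ S, (s : F) ≠ 0 ∧ (s : F)⁻¹ ∈ R) :
    IntOn (↑D : Set F) ↑R ⊆ IntOn (mlocSet D ↑S) ↑R := by
  suffices H : ∀ (n : ℕ) (f : F[X]), (∀ m, n ≤ m → f.coeff m = 0) →
      f ∈ IntOn (↑D : Set F) ↑R → f ∈ IntOn (mlocSet D ↑S) ↑R from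
    fun f hf => H (f.natDegree + 1) f (fun m hm => coeff_eq_zero_of_natDegree_lt hm) hf
  intro n
  induction n with
  | zero =>
    intro f hf _ x _
    have : f = 0 := by ext m; simpa using hf m (Nat.zero_le m)
    simp [this, R.zero_mem]
  | succ n ih =>
    rintro f hf hfD x ⟨a, s, hs, hx⟩
    have hg := ih (C ((s : F) ^ n) * f - f.comp (C (s : F) * X)) ?_ ?_ x ⟨a, s, hs, hx⟩
    · simp only [eval_sub, eval_mul, eval_C, eval_comp, eval_X, hx] at hg
      have h := R.add_mem hg (hfD a a.2)
      rw [sub_add_cancel] at h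
      have h' := R.mul_mem (R.pow_mem (hS s hs).2 n) h
      rwa [← mul_assoc, ← mul_pow, inv_mul_cancel₀ (hS s hs).1, one_pow, one_mul] at h'
    · intro m hm
      rw [coeff_sub, coeff_C_mul, comp_C_mul_X_coeff]
      rcases hm.eq_or_lt with rfl | hm
      · ring
      · simp [hf m hm]
    · intro y hy
      simp only [eval_sub, eval_mul, eval_C, eval_comp, eval_X]
      exact R.sub_mem (R.mul_mem (R.pow_mem (hDR s.2) n) (hfD y hy))
        (hfD _ (D.mul_mem s.2 hy))

/-- `Int(D, S⁻¹D) = Int(S⁻¹D)`. -/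
theorem intOn_mlocSet (D : Subring F) (S : Submonoid ↥D) (h0 : (0 : ↥D) ∉ S) :
    IntOn (↑D : Set F) (mlocSet D ↑S) = IntR (mlocSet D ↑S) := by
  refine Set.Subset.antisymm ?_ fun f hf x hx => hf x (le_mlocSubring D S hx)
  exact intOn_subset_intOn_mlocSet (le_mlocSubring D S) S fun s hs =>
    ⟨fun h => h0 (by rwa [← ZeroMemClass.coe_eq_zero.mp h]), inv_mem_mlocSubring h0 hs⟩

theorem mlocPoly_subset_intOn (D : Subring F) (S : Set ↥D) :
    mlocPoly D S (IntR (↑D : Set F)) ⊆ IntOn (↑D : Set F) (mlocSet D S) := by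
  rintro f ⟨g, hg, s, hs, rfl⟩ x hx
  exact ⟨⟨_, hg x hx⟩, s, hs, by simp⟩

theorem mlocPoly_subset (D : Subring F) (S : Submonoid ↥D) (h0 : (0 : ↥D) ∉ S) :
    mlocPoly D ↑S (IntR (↑D : Set F)) ⊆ IntR (mlocSet D ↑S) := by
  rw [← intOn_mlocSet D S h0]
  exact mlocPoly_subset_intOn D ↑S

theorem zero_notMem_primeCompl {D : Subring F} (p : Ideal ↥D) [p.IsPrime] :
    (0 : ↥D) ∉ p.primeCompl := fun h => h p.zero_mem

theorem plocSet_eq (D : Subring F) (p : Ideal ↥D) [p.IsPrime] :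
    plocSet D p = mlocSet D ↑p.primeCompl := rfl

/-- `{d ∈ D : d f ∈ Int(D)}` as an ideal of `D`. -/
def intColon (D : Subring F) (f : F[X]) : Ideal ↥D where
  carrier := {d | C (d : F) * f ∈ IntR (↑D : Set F)}
  zero_mem' := fun x _ => by simp [D.zero_mem]
  add_mem' := fun {a b} ha hb => by
    have : C ((a + b : ↥D) : F) * f ∈ IntSubring D := by
      rw [Subring.coe_add, C_add, add_mul]
      exact (IntSubring D).add_mem ha hb
    exact this
  smul_mem' := fun c d hd x hx => by
    have := D.mul_mem c.2 (hd x hx)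
    simpa [mul_assoc] using this

theorem mem_intColon {D : Subring F} {f : F[X]} {d : ↥D} :
    d ∈ intColon D f ↔ C (d : F) * f ∈ IntR (↑D : Set F) := Iff.rfl

theorem mem_mlocPoly_iff {D : Subring F} {S : Set ↥D} {f : F[X]} :
    f ∈ mlocPoly D S (IntR (↑D : Set F)) ↔ ∃ s ∈ S, s ∈ intColon D f :=
  ⟨fun ⟨_, hg, s, hs, h⟩ => ⟨s, hs, mem_intColon.2 (h ▸ hg)⟩, fun ⟨s, hs, h⟩ => ⟨_, h, s, hs, rfl⟩⟩

/-- If `Int(D_p) = Int(D)_p` for all primes `p`, then `Int(S⁻¹D) = S⁻¹Int(D)` for all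
multiplicative sets `S`. -/
theorem mloc_of_ploc (D : Subring F)
    (H : ∀ p : Ideal ↥D, p.IsPrime → IntR (plocSet D p) = plocPoly D p (IntR (↑D : Set F)))
    (S : Submonoid ↥D) (h0 : (0 : ↥D) ∉ S) :
    IntR (mlocSet D ↑S) = mlocPoly D ↑S (IntR (↑D : Set F)) := by
  refine Set.Subset.antisymm (fun f hf => ?_) (mlocPoly_subset D S h0)
  rw [mem_mlocPoly_iff]
  by_contra! hd
  obtain ⟨p, hp, hle, hdis⟩ := Ideal.exists_le_prime_disjoint (intColon D f) S
    (Set.disjoint_left.2 fun d hd1 hd2 => hd d hd2 hd1)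
  have hfp : f ∈ IntR (plocSet D p) := by
    rw [plocSet_eq, ← intOn_mlocSet D _ (zero_notMem_primeCompl p)]
    exact fun x hx => mlocSet_mono D (fun s hs hsp => Set.disjoint_left.1 hdis hsp hs)
      (hf x (le_mlocSubring D S hx))
  rw [H p hp] at hfp
  obtain ⟨s, hs, hsf⟩ := mem_mlocPoly_iff.1 hfp
  exact hs (hle hsf)

/-- The overring `S⁻¹D` is flat. -/
theorem flat_mlocSubring (D : Subring F) (S : Submonoid ↥D) (h0 : (0 : ↥D) ∉ S) :
    Module.Flat ↥D ↥(subringSubmodule D (mlocSubring D S) (le_mlocSubring D S)) := by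
  let : Algebra ↥D ↥(mlocSubring D S) := (Subring.inclusion (le_mlocSubring D S)).toAlgebra
  have hne : ∀ s ∈ S, (s : F) ≠ 0 := fun s hs h =>
    h0 (by rwa [← ZeroMemClass.coe_eq_zero.mp h])
  have hcoe : ∀ d : ↥D, ((algebraMap ↥D ↥(mlocSubring D S) d : ↥(mlocSubring D S)) : F) = d :=
    fun _ => rfl
  have : IsLocalization S ↥(mlocSubring D S) := by
    refine ⟨fun s => ?_, fun z => ?_, fun {x y} h => ⟨1, ?_⟩⟩
    · refine IsUnit.of_mul_eq_one ⟨(s : F)⁻¹, inv_mem_mlocSubring h0 s.2⟩ (Subtype.ext ?_)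
      rw [Subring.coe_mul, hcoe]
      exact mul_inv_cancel₀ (hne s s.2)
    · obtain ⟨a, s, hs, hz⟩ := mem_mlocSubring.1 z.2
      refine ⟨(a, ⟨s, hs⟩), Subtype.ext ?_⟩
      rw [Subring.coe_mul, hcoe, hcoe, mul_comm]
      exact hz
    · have : (x : F) = y := by rw [← hcoe, ← hcoe, h]
      rw [Subtype.ext this]
  have : Module.Flat ↥D ↥(mlocSubring D S) := IsLocalization.flat _ S
  exact Module.Flat.of_linearEquiv
    ({ toFun := fun x => ⟨x.1, x.2⟩
       invFun := fun x => ⟨x.1, x.2⟩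
       map_add' := fun _ _ => rfl
       map_smul' := fun _ _ => rfl
       left_inv := fun _ => rfl
       right_inv := fun _ => rfl } :
      ↥(subringSubmodule D (mlocSubring D S) (le_mlocSubring D S)) ≃ₗ[↥D] ↥(mlocSubring D S))

/-- Every element of `S⁻¹D · Int(D)` lies in `S⁻¹Int(D)`. -/
theorem span_mlocSubring_subset (D : Subring F) (S : Submonoid ↥D) :
    (Submodule.span ↥(mlocSubring D S) (IntR (↑D : Set F)) : Set F[X]) ⊆
      mlocPoly D ↑S (IntR (↑D : Set F)) := by
  intro f hf
  rw [mem_mlocPoly_iff]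
  induction hf using Submodule.span_induction with
  | mem f hf => exact ⟨1, S.one_mem, by simpa [mem_intColon] using hf⟩
  | zero => exact ⟨1, S.one_mem, fun x _ => by simp [D.zero_mem]⟩
  | add f g _ _ hf hg =>
    obtain ⟨s, hs, hf⟩ := hf
    obtain ⟨t, ht, hg⟩ := hg
    refine ⟨s * t, S.mul_mem hs ht, ?_⟩
    rw [mem_intColon, mul_add]
    exact (IntSubring D).add_mem ((intColon D f).mul_mem_right t hf)
      ((intColon D g).mul_mem_left s hg)
  | smul c f _ hf =>
    obtain ⟨s, hs, hf⟩ := hf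
    obtain ⟨a, t, ht, hc⟩ := mem_mlocSubring.1 c.2
    refine ⟨t * s, S.mul_mem ht hs, ?_⟩
    have h := (intColon D f).mul_mem_left a hf
    rw [mem_intColon] at h ⊢
    convert h using 1
    have : c • f = C (c : F) * f := by rw [Algebra.smul_def]; rfl
    rw [this, Subring.coe_mul, Subring.coe_mul, ← hc]
    simp only [C_mul]
    ring

/-- For a flat overring `D'` and `x ∈ D'`, the conductor `(D : x)` generates the unit ideal of
`D'`, so it is not contained in any proper ideal of `D'`. -/
theorem exists_denom_of_flat {D D' : Subring F} (hqf : IsQuotField D) (h : D ≤ D')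
    (hflat : Module.Flat ↥D ↥(subringSubmodule D D' h)) (m : Ideal ↥D') (hm : m ≠ ⊤)
    {x : F} (hx : x ∈ D') :
    ∃ s : ↥D, (⟨s, h s.2⟩ : ↥D') ∉ m ∧ (s : F) * x ∈ D := by
  obtain ⟨a, b, hb, hab⟩ := hqf x
  have hrel : ∑ i, (![b, -a] : Fin 2 → ↥D) i •
      (![⟨x, hx⟩, ⟨1, D'.one_mem⟩] : Fin 2 → ↥(subringSubmodule D D' h)) i = 0 := by
    apply Subtype.ext
    simp only [Fin.sum_univ_two, Matrix.cons_val_zero, Matrix.cons_val_one]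
    change (b : F) * x + ((-a : ↥D) : F) * 1 = 0
    rw [hab]
    push_cast
    ring
  obtain ⟨k, c, y, hcy, hc⟩ := Module.Flat.isTrivialRelation_of_sum_smul_eq_zero hrel
  by_contra! hcon
  apply hm
  rw [Ideal.eq_top_iff_one]
  have h1 : (1 : ↥D') = ∑ j, (⟨(c 1 j : F), h (c 1 j).2⟩ : ↥D') * ⟨(y j : F), (y j).2⟩ := by
    apply Subtype.ext
    have := congrArg (fun z : ↥(subringSubmodule D D' h) => (z : F)) (hcy 1)
    simp only [Matrix.cons_val_one, Submodule.coe_sum] at this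
    simpa [Subring.smul_def] using this
  rw [h1]
  refine Ideal.sum_mem _ fun j _ => m.mul_mem_right _ ?_
  by_contra hj
  refine hcon _ hj ?_
  have hb' : (b : F) ≠ 0 := fun h0 => hb (ZeroMemClass.coe_eq_zero.mp h0)
  have h2 := congrArg (fun z : ↥D => (z : F)) (hc j)
  simp only [Fin.sum_univ_two, Matrix.cons_val_zero, Matrix.cons_val_one] at h2
  push_cast at h2
  have : (c 1 j : F) * x = c 0 j := by
    apply mul_left_cancel₀ hb'
    linear_combination (c 1 j : F) * hab - h2
  rw [this]
  exact (c 0 j).2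

theorem span_subset_intOn {D D' : Subring F} (h : D ≤ D') :
    (Submodule.span ↥D' (IntR (↑D : Set F)) : Set F[X]) ⊆ IntOn (↑D : Set F) ↑D' := by
  intro f hf x hx
  induction hf using Submodule.span_induction with
  | mem f hf => exact h (hf x hx)
  | zero => simp [D'.zero_mem]
  | add f g _ _ hf hg => rw [eval_add]; exact D'.add_mem hf hg
  | smul c f _ hf =>
    have : c • f = C (c : F) * f := by rw [Algebra.smul_def]; rfl
    rw [this, eval_mul, eval_C]
    exact D'.mul_mem c.2 hf

theorem flat_regular_of_ploc {D : Subring F} (hqf : IsQuotField D)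
    (H : ∀ p : Ideal ↥D, p.IsPrime → IntR (plocSet D p) = plocPoly D p (IntR (↑D : Set F)))
    (D' : Subring F) (h : D ≤ D') (hflat : Module.Flat ↥D ↥(subringSubmodule D D' h)) :
    IntOn (↑D : Set F) ↑D' = (Submodule.span ↥D' (IntR (↑D : Set F)) : Set F[X]) := by
  refine Set.Subset.antisymm (fun f hf => ?_) (span_subset_intOn h)
  let N : Submodule ↥D' F[X] := Submodule.span ↥D' (IntR (↑D : Set F))
  let J : Ideal ↥D' := N.comap (LinearMap.toSpanSingleton ↥D' F[X] f)
  have hJ : ∀ d, d ∈ J ↔ d • f ∈ N := fun d => Iff.rfl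
  suffices hJt : J = ⊤ by
    have := (hJ 1).1 (hJt ▸ Submodule.mem_top)
    rwa [one_smul] at this
  by_contra hJt
  obtain ⟨m, hm, hJm⟩ := J.exists_le_maximal hJt
  let p : Ideal ↥D := m.comap (Subring.inclusion h)
  have hp : p.IsPrime := Ideal.comap_isPrime _ _
  have hfp : f ∈ IntR (plocSet D p) := by
    rw [plocSet_eq, ← intOn_mlocSet D _ (zero_notMem_primeCompl p)]
    intro x hx
    obtain ⟨s, hs, hsx⟩ := exists_denom_of_flat hqf h hflat m hm.ne_top (hf x hx)
    exact ⟨⟨_, hsx⟩, s, hs, rfl⟩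
  rw [H p hp] at hfp
  obtain ⟨s, hs, hsf⟩ := mem_mlocPoly_iff.1 hfp
  refine hs (hJm ((hJ _).2 ?_))
  have : Subring.inclusion h s • f = C (s : F) * f := by rw [Algebra.smul_def]; rfl
  rw [this]
  exact Submodule.subset_span hsf

theorem mloc_of_flat_regular (D : Subring F)
    (H : ∀ D' : Subring F, ∀ h : D ≤ D', Module.Flat ↥D ↥(subringSubmodule D D' h) →
      IntOn (↑D) (↑D') = (Submodule.span ↥D' (IntR (↑D : Set F)) : Set F[X]))
    (S : Submonoid ↥D) (h0 : (0 : ↥D) ∉ S) :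
    IntR (mlocSet D ↑S) = mlocPoly D ↑S (IntR (↑D : Set F)) := by
  refine Set.Subset.antisymm ?_ (mlocPoly_subset D S h0)
  rw [← intOn_mlocSet D S h0, ← coe_mlocSubring,
    H _ (le_mlocSubring D S) (flat_mlocSubring D S h0)]
  exact span_mlocSubring_subset D S

/-- The ideal `{d ∈ D : d f ∈ R[X]}` of `D`, for an overring `R` of `D`. -/
def coeffColon (D R : Subring F) (h : D ≤ R) (f : F[X]) : Ideal ↥D where
  carrier := {d | ∀ n, (d : F) * f.coeff n ∈ R}
  zero_mem' := by simp [R.zero_mem]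
  add_mem' := fun {a b} ha hb n => by
    rw [Subring.coe_add, add_mul]
    exact R.add_mem (ha n) (hb n)
  smul_mem' := fun c d hd n => by
    rw [smul_eq_mul, Subring.coe_mul, mul_assoc]
    exact R.mul_mem (h c.2) (hd n)

theorem mem_coeffColon {D R : Subring F} {h : D ≤ R} {f : F[X]} {d : ↥D} :
    d ∈ coeffColon D R h f ↔ ∀ n, (d : F) * f.coeff n ∈ R := Iff.rfl

theorem coeffColon_le_intColon (D : Subring F) (f : F[X]) :
    coeffColon D D le_rfl f ≤ intColon D f := by
  intro d hd x hx
  rw [eval_eq_sum_range]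
  refine D.sum_mem fun i _ => D.mul_mem ?_ (D.pow_mem hx i)
  rw [coeff_C_mul]
  exact hd i

theorem exists_mem_coeffColon (D : Subring F) (S : Submonoid ↥D) (f : F[X])
    (hf : ∀ n, f.coeff n ∈ mlocSubring D S) : ∃ s ∈ S, s ∈ coeffColon D D le_rfl f := by
  classical
  obtain ⟨s, hs, h⟩ := exists_common_denom D S f.coeffs fun t ht => by
    obtain ⟨n, _, rfl⟩ := mem_coeffs_iff.1 ht
    exact hf n
  refine ⟨s, hs, fun n => ?_⟩
  by_cases hn : f.coeff n = 0
  · rw [hn, mul_zero]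
    exact D.zero_mem
  · exact h _ (coeff_mem_coeffs hn)

theorem coeffColon_ne_bot {D : Subring F} (hqf : IsQuotField D) (f : F[X]) :
    coeffColon D D le_rfl f ≠ ⊥ := by
  obtain ⟨s, hs, h⟩ := exists_mem_coeffColon D (nonZeroDivisors ↥D) f fun n => by
    obtain ⟨a, b, hb, hab⟩ := hqf (f.coeff n)
    exact ⟨a, b, mem_nonZeroDivisors_of_ne_zero hb, hab⟩
  exact (Submodule.ne_bot_iff _).2 ⟨s, h, nonZeroDivisors.ne_zero hs⟩

/-- If `D/p` is infinite, then `Int(D_p) ⊆ D_p[X]`, by Lagrange interpolation. -/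
theorem coeff_mem_of_infinite_quotient {D : Subring F} (p : Ideal ↥D) [p.IsPrime]
    (hinf : Infinite (↥D ⧸ p)) {f : F[X]}
    (hf : f ∈ IntOn (↑D : Set F) ↑(mlocSubring D p.primeCompl)) (n : ℕ) :
    f.coeff n ∈ mlocSubring D p.primeCompl := by
  classical
  set R := mlocSubring D p.primeCompl
  obtain ⟨s, hs⟩ := Infinite.exists_subset_card_eq (↥D ⧸ p) (f.natDegree + 1)
  let w : ↥D ⧸ p → ↥D := Quotient.out
  have hw : ∀ i, Ideal.Quotient.mk p (w i) = i := fun i => Quotient.out_eq i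
  let v : ↥D ⧸ p → F := fun i => w i
  have hvD : ∀ i, v i ∈ D := fun i => (w i).2
  have hv : Function.Injective v := fun i j hij => by
    rw [← hw i, ← hw j, Subtype.ext hij]
  have hinv : ∀ i j, i ≠ j → (v i - v j)⁻¹ ∈ R := fun i j hij => by
    refine inv_mem_mlocSubring (s := w i - w j) (zero_notMem_primeCompl p) fun hmem => hij ?_
    rw [← hw i, ← hw j]
    exact Ideal.Quotient.eq.2 hmem
  have hC : ∀ x ∈ R, C x ∈ liftsRing R.subtype := fun x hx =>
    C'_mem_lifts ⟨⟨x, hx⟩, rfl⟩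
  have hlift : f ∈ liftsRing R.subtype := by
    rw [Lagrange.eq_interpolate (f := f) (s := s) (v := v) hv.injOn
      (lt_of_le_of_lt degree_le_natDegree (by rw [hs]; exact_mod_cast Nat.lt_succ_self _)),
      Lagrange.interpolate_apply]
    refine Subring.sum_mem _ fun i _ => Subring.mul_mem _ (hC _ (hf _ (hvD i))) ?_
    refine Subring.prod_mem _ fun j hj => Subring.mul_mem _
      (hC _ (hinv i j (Finset.ne_of_mem_erase hj).symm)) (Subring.sub_mem _ ?_ ?_)
    · exact X_mem_lifts _
    · exact hC _ (le_mlocSubring D _ (hvD j))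
  obtain ⟨z, hz⟩ := (lifts_iff_coeff_lifts f).1 hlift n
  exact hz ▸ z.2

theorem exists_mul_pow_mem_of_mem_minimalPrimes {A : Type*} [CommRing A] {I q : Ideal A}
    (hq : q ∈ I.minimalPrimes) {y : A} (hy : y ∈ q) : ∃ u ∉ q, ∃ n : ℕ, u * y ^ n ∈ I := by
  have := hq.1.1
  by_contra! hcon
  obtain ⟨P, hP, hIP, hdis⟩ := Ideal.exists_le_prime_disjoint I
    (q.primeCompl ⊔ Submonoid.powers y) (Set.disjoint_left.2 fun z hz hzS => by
      obtain ⟨u, hu, t, ⟨n, rfl⟩, rfl⟩ := Submonoid.mem_sup.1 hzS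
      exact hcon u hu n hz)
  have hPq : P ≤ q := fun z hz => by
    by_contra hzq
    exact Set.disjoint_left.1 hdis hz
      ((le_sup_left : q.primeCompl ≤ q.primeCompl ⊔ Submonoid.powers y) hzq)
  exact Set.disjoint_left.1 hdis (hq.2 ⟨hP, hIP⟩ hPq hy)
    ((le_sup_right : Submonoid.powers y ≤ q.primeCompl ⊔ Submonoid.powers y)
      (Submonoid.mem_powers y))

/-- If `I⁻¹ ⊆ R`, then `(R : I^N) ⊆ R`. -/
theorem mem_of_pow_mul_mem {D R : Subring F} (I : Ideal ↥D)
    (hI : ∀ z : F, (∀ y ∈ I, (y : F) * z ∈ R) → z ∈ R) (N : ℕ) :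
    ∀ z : F, (∀ y ∈ I ^ N, (y : F) * z ∈ R) → z ∈ R := by
  induction N with
  | zero => exact fun z hz => by simpa using hz 1 (by simp)
  | succ N ih =>
    refine fun z hz => ih z fun y hy => hI _ fun t ht => ?_
    have := hz (y * t) (by rw [pow_succ]; exact Ideal.mul_mem_mul hy ht)
    rw [Subring.coe_mul] at this
    convert this using 1
    ring

theorem subset_dt {D I : Set F} (h : ∃ y ∈ I, y ≠ 0) : I ⊆ dt D I := by
  classical
  obtain ⟨y, hy, hy0⟩ := h
  intro x hx
  refine ⟨{x, y}, by simp [Set.insert_subset_iff, hx, hy], ⟨y, by simp, hy0⟩, fun z hz => ?_⟩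
  rw [mul_comm]
  exact hz x (by simp)

theorem mem_of_mem_dv {D : Subring F} {I : Set F} (hI : I ⊆ ↑D) {x : F}
    (hx : x ∈ dv (↑D : Set F) I) : x ∈ D := by
  simpa using hx 1 fun y hy => by simpa using hI hy

theorem plocIdl_subset {D : Subring F} (p : Ideal ↥D) : plocIdl D p ⊆ plocSet D p :=
  fun _ ⟨y, _, s, hs, h⟩ => ⟨y, s, hs, h⟩

theorem iset_subset_plocIdl {D : Subring F} (p : Ideal ↥D) [hp : p.IsPrime] :
    iset D ↑p ⊆ plocIdl D p := by
  rintro _ ⟨y, hy, rfl⟩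
  exact ⟨y, hy, 1, fun h => hp.ne_top ((Ideal.eq_top_iff_one p).2 h), by simp⟩

/-- A prime minimal over `{d ∈ D : d f ∈ D[X]}` is t-localizing. -/
theorem tLocalizing_of_mem_minimalPrimes {D : Subring F} (hqf : IsQuotField D) {f : F[X]}
    {q : Ideal ↥D} (hq : q ∈ (coeffColon D D le_rfl f).minimalPrimes) : TLocalizing D q := by
  classical
  have := hq.1.1
  obtain ⟨c, hc, hc0⟩ := (Submodule.ne_bot_iff _).1 (coeffColon_ne_bot hqf f)
  have hc0' : (c : F) ≠ 0 := fun h => hc0 (ZeroMemClass.coe_eq_zero.mp h)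
  refine Set.Subset.antisymm ?_
    (subset_dt ⟨c, iset_subset_plocIdl q ⟨c, hq.1.2 hc, rfl⟩, hc0'⟩)
  rintro x ⟨T, hTq, -, hxT⟩
  set R := mlocSubring D q.primeCompl
  have hxR : x ∈ R := mem_of_mem_dv (D := R) (hTq.trans (plocIdl_subset q)) hxT
  obtain ⟨a, s, hs, hx⟩ := mem_mlocSubring.1 hxR
  by_cases ha : a ∈ q
  · exact ⟨a, ha, s, hs, hx⟩
  exfalso
  have hinv : (a : F)⁻¹ ∈ R := inv_mem_mlocSubring (zero_notMem_primeCompl q) ha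
  have ha0 : (a : F) ≠ 0 := fun h => ha (by rw [ZeroMemClass.coe_eq_zero.mp h]; exact q.zero_mem)
  choose! y hyq t htq hyt using fun (z : F) (hz : z ∈ (T : Set F)) => hTq hz
  let I : Ideal ↥D := Ideal.span (y '' (T : Set F))
  have hIR : ∀ z : F, (∀ y ∈ I, (y : F) * z ∈ R) → z ∈ R := by
    intro z hz
    have hxz : x * z ∈ R := hxT z fun w hw => by
      have h1 := hz (y w) (Ideal.subset_span ⟨w, hw, rfl⟩)
      have h2 : ((t w : ↥D) : F)⁻¹ ∈ R :=
        inv_mem_mlocSubring (zero_notMem_primeCompl q) (htq w hw)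
      have ht0 : ((t w : ↥D) : F) ≠ 0 := fun h => htq w hw (by
        rw [ZeroMemClass.coe_eq_zero.mp h]; exact q.zero_mem)
      have h3 := R.mul_mem h2 h1
      rw [← hyt w hw] at h3
      rw [mul_assoc, inv_mul_cancel_left₀ ht0, mul_comm] at h3
      exact h3
    have h4 := R.mul_mem (R.mul_mem hinv (le_mlocSubring D _ s.2)) hxz
    convert h4 using 1
    rw [show (a : F)⁻¹ * s * (x * z) = (a : F)⁻¹ * ((s : F) * x) * z by ring, hx,
      inv_mul_cancel₀ ha0, one_mul]
  have hIfg : I.FG := Submodule.fg_span (T.finite_toSet.image y)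
  have hrad : I ≤ (coeffColon D R (le_mlocSubring D _) f).radical := by
    refine Ideal.span_le.2 ?_
    rintro _ ⟨w, hw, rfl⟩
    obtain ⟨u, hu, n, hun⟩ := exists_mul_pow_mem_of_mem_minimalPrimes hq (hyq w hw)
    refine ⟨n, fun i => ⟨⟨_, hun i⟩, u, hu, ?_⟩⟩
    push_cast
    ring
  obtain ⟨N, hN⟩ := Ideal.exists_pow_le_of_le_radical_of_fg hrad hIfg
  obtain ⟨u, hu, huC⟩ := exists_mem_coeffColon D q.primeCompl f fun n =>
    mem_of_pow_mul_mem I hIR N _ fun y hy => hN hy n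
  exact hu (hq.1.2 huC)

/-- A nonzero t-localizing prime is a t-ideal. -/
theorem isTIdeal_of_tLocalizing {D : Subring F} {p : Ideal ↥D} [p.IsPrime] (hp0 : p ≠ ⊥)
    (hp : TLocalizing D p) : IsTIdeal (↑D : Set F) (iset D ↑p) := by
  obtain ⟨c, hc, hc0⟩ := (Submodule.ne_bot_iff _).1 hp0
  have hc0' : (c : F) ≠ 0 := fun h => hc0 (ZeroMemClass.coe_eq_zero.mp h)
  refine Set.Subset.antisymm ?_ (subset_dt ⟨c, ⟨c, hc, rfl⟩, hc0'⟩)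
  rintro x ⟨T, hTp, hT0, hxT⟩
  have hxD : x ∈ D := mem_of_mem_dv
    (hTp.trans (by rintro _ ⟨d, _, rfl⟩; exact d.2)) hxT
  have hxp : x ∈ plocIdl D p := by
    rw [← show dt (plocSet D p) (plocIdl D p) = plocIdl D p from hp]
    refine ⟨T, hTp.trans (iset_subset_plocIdl p), hT0, fun z hz => ?_⟩
    classical
    obtain ⟨s, hs, hsz⟩ := exists_common_denom D p.primeCompl (T.image (z * ·)) fun t ht => by
      obtain ⟨w, hw, rfl⟩ := Finset.mem_image.1 ht
      exact hz w hw
    have := hxT (s * z) fun w hw => by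
      rw [mul_assoc]
      exact hsz _ (Finset.mem_image_of_mem _ hw)
    exact ⟨⟨_, this⟩, s, hs, by ring⟩
  obtain ⟨y, hy, s, hs, hsx⟩ := hxp
  refine ⟨⟨x, hxD⟩, ?_, rfl⟩
  have : s * ⟨x, hxD⟩ ∈ p := by
    rw [show s * ⟨x, hxD⟩ = y from Subtype.ext hsx]
    exact hy
  exact (Ideal.IsPrime.mem_or_mem ‹_› this).resolve_left hs

/-- A t-maximal ideal is prime. -/
theorem IsTMax.isPrime {D : Subring F} {p : Ideal ↥D} (hp : IsTMax D p) : p.IsPrime := by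
  classical
  obtain ⟨hne, hpt, hmax⟩ := hp
  obtain ⟨y, hyp, hy0⟩ : ∃ y ∈ iset D ↑p, y ≠ 0 := by
    have h0 : (0 : F) ∈ dt (↑D : Set F) (iset D ↑p) := by
      rw [show dt (↑D : Set F) (iset D ↑p) = _ from hpt]
      exact ⟨0, p.zero_mem, rfl⟩
    obtain ⟨T, hT, ⟨y, hy, hy0⟩, -⟩ := h0
    exact ⟨y, hT hy, hy0⟩
  refine ⟨hne, fun {a b} hab => or_iff_not_imp_left.2 fun ha => ?_⟩
  have ha0 : (a : F) ≠ 0 := fun h => ha (by rw [ZeroMemClass.coe_eq_zero.mp h]; exact p.zero_mem)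
  let q : Ideal ↥D := Submodule.comap (LinearMap.mulLeft ↥D a) p
  have hq : ∀ d, d ∈ q ↔ a * d ∈ p := fun d => Iff.rfl
  have hpq : p ≤ q := fun d hd => (hq d).2 (p.mul_mem_left a hd)
  have hqne : q ≠ ⊤ := fun h => ha (by
    have := (hq 1).1 (h ▸ Submodule.mem_top)
    rwa [mul_one] at this)
  rw [hmax q hqne ?_ hpq]
  · exact (hq b).2 hab
  refine Set.Subset.antisymm ?_ (subset_dt ⟨y, Set.image_mono hpq hyp, hy0⟩)
  rintro x ⟨T, hTq, ⟨w, hw, hw0⟩, hxT⟩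
  have hxD : x ∈ D := mem_of_mem_dv
    (hTq.trans (by rintro _ ⟨d, _, rfl⟩; exact d.2)) hxT
  refine ⟨⟨x, hxD⟩, (hq _).2 ?_, rfl⟩
  have hax : (a : F) * x ∈ iset D ↑p := by
    rw [← show dt (↑D : Set F) (iset D ↑p) = _ from hpt]
    refine ⟨T.image ((a : F) * ·), ?_, ⟨_, Finset.mem_image_of_mem _ hw, mul_ne_zero ha0 hw0⟩,
      fun z hz => ?_⟩
    · intro t ht
      obtain ⟨u, hu, rfl⟩ := Finset.mem_image.1 ht
      obtain ⟨d, hd, rfl⟩ := hTq hu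
      exact ⟨a * d, hd, rfl⟩
    · have := hxT (z * a) fun u hu => by
        rw [mul_assoc]
        exact hz _ (Finset.mem_image_of_mem _ hu)
      convert this using 1
      ring
  obtain ⟨d, hd, hdx⟩ := hax
  rwa [show a * ⟨x, hxD⟩ = d from Subtype.ext hdx.symm]

/-- It is enough to test `Int(D_p) = Int(D)_p` at the t-localizing t-maximal ideals with finite
residue field. -/
theorem ploc_of_tMax {D : Subring F} (hqf : IsQuotField D)
    (H : ∀ p : Ideal ↥D, IsTMax D p → TLocalizing D p → Finite (↥D ⧸ p) →
      IntR (plocSet D p) = plocPoly D p (IntR (↑D : Set F)))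
    (p : Ideal ↥D) (hp : p.IsPrime) :
    IntR (plocSet D p) = plocPoly D p (IntR (↑D : Set F)) := by
  refine Set.Subset.antisymm (fun f hf => ?_)
    (mlocPoly_subset D p.primeCompl (zero_notMem_primeCompl p))
  by_cases hC : coeffColon D D le_rfl f ≤ p
  · obtain ⟨q, hq, hqp⟩ := Ideal.exists_minimalPrimes_le hC
    have := hq.1.1
    have hfq : f ∈ IntOn (↑D : Set F) ↑(mlocSubring D q.primeCompl) := fun x hx =>
      mlocSet_mono D (Set.compl_subset_compl.2 hqp) (hf x (le_mlocSubring D p.primeCompl hx))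
    have hfin : Finite (↥D ⧸ q) := by
      by_contra hinf
      rw [not_finite_iff_infinite] at hinf
      obtain ⟨s, hs, hsC⟩ := exists_mem_coeffColon D q.primeCompl f
        (coeff_mem_of_infinite_quotient q hinf hfq)
      exact hs (hq.1.2 hsC)
    have hqmax : q.IsMaximal :=
      Ideal.Quotient.maximal_of_isField q (Finite.isField_of_domain _)
    obtain rfl : q = p := hqmax.eq_of_le hp.ne_top hqp
    have hq0 : q ≠ ⊥ := fun h => coeffColon_ne_bot hqf f (le_bot_iff.1 (h ▸ hC))
    have hqt := tLocalizing_of_mem_minimalPrimes hqf hq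
    rw [← H q ⟨hp.ne_top, isTIdeal_of_tLocalizing hq0 hqt,
      fun r hr _ hqr => hqmax.eq_of_le hr hqr⟩ hqt hfin]
    exact hf
  · obtain ⟨s, hsC, hs⟩ := SetLike.not_le_iff_exists.1 hC
    exact mem_mlocPoly_iff.2 ⟨s, hs, coeffColon_le_intColon D f hsC⟩

/-- If `Int(D_p) = D_p[X]`, then `Int(D_p) = Int(D)_p`. -/
theorem ploc_of_eq_polySet {D : Subring F} (p : Ideal ↥D) [p.IsPrime]
    (h : IntR (plocSet D p) = polySet (plocSet D p)) :
    IntR (plocSet D p) = plocPoly D p (IntR (↑D : Set F)) := by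
  refine Set.Subset.antisymm (fun f hf => ?_)
    (mlocPoly_subset D p.primeCompl (zero_notMem_primeCompl p))
  rw [h] at hf
  obtain ⟨s, hs, hsC⟩ := exists_mem_coeffColon D p.primeCompl f hf
  exact mem_mlocPoly_iff.2 ⟨s, hs, coeffColon_le_intColon D f hsC⟩

end IVP

open IVP Polynomial

/-- Characterizations of polynomially L-regular domains: the
following are equivalent.
(1) Every flat overring `D'` of `D` is polynomially regular: `Int(D,D') = D'·Int(D)`.
(2) `Int(S⁻¹D) = S⁻¹Int(D)` for every multiplicative subset `S` with `0 ∉ S`.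
(3) `Int(D_p) = Int(D)_p` for every prime `p`.
(4) `Int(D_p) = Int(D)_p` for every t-localizing t-maximal `p` with finite residue
field.
(5) `Int(D_p) = Int(D)_p` for every prime `p` with `Int(D_p) ≠ D_p[X]`. -/
theorem stmt_11 (F : Type) [Field F] (D : Subring F)
    (hqf : IsQuotField D) (hne : (↑D : Set F) ≠ Set.univ) :
    ((∀ D' : Subring F, ∀ h : D ≤ D',
        Module.Flat ↥D ↥(subringSubmodule D D' h) →
          IntOn (↑D) (↑D') = (Submodule.span ↥D' (IntR (↑D : Set F)) : Set (Polynomial F))) ↔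
      ∀ S : Submonoid ↥D, (0 : ↥D) ∉ S →
        IntR (mlocSet D ↑S) = mlocPoly D ↑S (IntR (↑D : Set F))) ∧
    ((∀ S : Submonoid ↥D, (0 : ↥D) ∉ S →
        IntR (mlocSet D ↑S) = mlocPoly D ↑S (IntR (↑D : Set F))) ↔
      ∀ p : Ideal ↥D, p.IsPrime →
        IntR (plocSet D p) = plocPoly D p (IntR (↑D : Set F))) ∧
    ((∀ p : Ideal ↥D, p.IsPrime →
        IntR (plocSet D p) = plocPoly D p (IntR (↑D : Set F))) ↔
      ∀ p : Ideal ↥D, IsTMax D p → TLocalizing D p → Finite (↥D ⧸ p) →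
        IntR (plocSet D p) = plocPoly D p (IntR (↑D : Set F))) ∧
    ((∀ p : Ideal ↥D, IsTMax D p → TLocalizing D p → Finite (↥D ⧸ p) →
        IntR (plocSet D p) = plocPoly D p (IntR (↑D : Set F))) ↔
      ∀ p : Ideal ↥D, p.IsPrime → IntR (plocSet D p) ≠ polySet (plocSet D p) →
        IntR (plocSet D p) = plocPoly D p (IntR (↑D : Set F))) := by
  have h32 := mloc_of_ploc D
  have h23 : (∀ S : Submonoid ↥D, (0 : ↥D) ∉ S →
        IntR (mlocSet D ↑S) = mlocPoly D ↑S (IntR (↑D : Set F))) →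
      ∀ p : Ideal ↥D, p.IsPrime →
        IntR (plocSet D p) = plocPoly D p (IntR (↑D : Set F)) :=
    fun H p _ => H p.primeCompl (zero_notMem_primeCompl p)
  have h43 := ploc_of_tMax hqf
  refine ⟨⟨mloc_of_flat_regular D, fun H => flat_regular_of_ploc hqf (h23 H)⟩, ⟨h23, h32⟩,
    ⟨fun H p hp _ _ => H p hp.isPrime, h43⟩, fun H p hp _ => h43 H p hp, fun H p hp _ _ => ?_⟩
  have := hp.isPrime
  by_cases h : IntR (plocSet D p) = polySet (plocSet D p)
  · exact ploc_of_eq_polySet p h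
  · exact H p hp.isPrime h
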